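/- The map (ev_a, ev_b): A_𝒯^{[a,b]} → J^+ ∩ (M_a × M_b), γ ↦ (γ(a),γ(b)), is a continuous proper surjection admitting a Borel measurable right inverse. -/

import Mathlib

open Set Topology

/-- Intersecting a compact-valued map with the minimisers of a continuous function preserves
measurability of the hitting sets of closed sets. -/
theorem measurableSet_hit_argmin {X Y : Type*} [TopologicalSpace X] [MeasurableSpace Y]
    {F : Y → Set X} (hcomp : ∀ y, IsCompact (F y))
    (hF : ∀ C, IsClosed C → MeasurableSet {y | (F y ∩ C).Nonempty})
    {φ : X → ℝ} (hφ : Continuous φ) {C : Set X} (hC : IsClosed C) :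
    MeasurableSet {y | ({x ∈ F y | IsMinOn φ (F y) x} ∩ C).Nonempty} := by
  have key : {y | ({x ∈ F y | IsMinOn φ (F y) x} ∩ C).Nonempty} =
      {y | (F y ∩ C).Nonempty} ∩ ⋂ q : ℚ, ({y | (F y ∩ {x | φ x ≤ q}).Nonempty}ᶜ ∪
        {y | (F y ∩ (C ∩ {x | φ x ≤ q})).Nonempty}) := by
    ext y
    simp only [mem_inter_iff, mem_iInter, mem_union, mem_compl_iff, mem_ofPred_eq]
    constructor
    · rintro ⟨x, ⟨hx, hmin⟩, hxC⟩
      refine ⟨⟨x, hx, hxC⟩, fun q => ?_⟩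
      rw [or_iff_not_imp_left, not_not]
      rintro ⟨z, hz, hzq⟩
      exact ⟨x, hx, hxC, (isMinOn_iff.mp hmin z hz).trans hzq⟩
    · rintro ⟨hn, h⟩
      obtain ⟨x, hx, hmin⟩ := ((hcomp y).inter_right hC).exists_isMinOn hn hφ.continuousOn
      refine ⟨x, ⟨hx.1, isMinOn_iff.mpr fun z hz => ?_⟩, hx.2⟩
      by_contra hlt
      obtain ⟨q, hzq, hqx⟩ := exists_rat_btwn (not_le.mp hlt)
      rcases h q with h | ⟨w, hw, hwC, hwq⟩
      · exact h ⟨z, hz, hzq.le⟩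
      · exact absurd (isMinOn_iff.mp hmin w ⟨hw, hwC⟩) (not_le.mpr (lt_of_le_of_lt hwq hqx))
  rw [key]
  have hle (q : ℚ) : IsClosed {x | φ x ≤ q} := isClosed_le hφ continuous_const
  exact (hF C hC).inter (MeasurableSet.iInter fun q =>
    (hF _ (hle q)).compl.union (hF _ (hC.inter (hle q))))

/-- Successive restriction of a set-valued map to the minimisers of a sequence of functions. -/
def iteratedArgmin {X Y : Type*} (F : Y → Set X) (φ : ℕ → X → ℝ) : ℕ → Y → Set X
  | 0 => F
  | n + 1 => fun y =>
      {x ∈ iteratedArgmin F φ n y | IsMinOn (φ n) (iteratedArgmin F φ n y) x}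

/-- Measurable selection theorem for compact-valued maps into a separable metric space. -/
theorem exists_measurable_selection_of_isCompact {X Y : Type*} [MetricSpace X]
    [TopologicalSpace.SeparableSpace X] [MeasurableSpace X] [BorelSpace X] [MeasurableSpace Y]
    (F : Y → Set X) (hne : ∀ y, (F y).Nonempty) (hcomp : ∀ y, IsCompact (F y))
    (hF : ∀ C, IsClosed C → MeasurableSet {y | (F y ∩ C).Nonempty}) :
    ∃ r : Y → X, Measurable r ∧ ∀ y, r y ∈ F y := by
  rcases isEmpty_or_nonempty Y with hY | ⟨⟨y₀⟩⟩
  · exact ⟨isEmptyElim, measurable_of_empty _, isEmptyElim⟩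
  have : Nonempty X := ⟨(hne y₀).some⟩
  let φ (n : ℕ) (x : X) : ℝ := dist x (TopologicalSpace.denseSeq X n)
  have hφ (n : ℕ) : Continuous (φ n) := continuous_id.dist continuous_const
  let G := iteratedArgmin F φ
  have hG (n : ℕ) : (∀ y, (G n y).Nonempty) ∧ (∀ y, IsCompact (G n y)) ∧
      ∀ C, IsClosed C → MeasurableSet {y | (G n y ∩ C).Nonempty} := by
    induction n with
    | zero => exact ⟨hne, hcomp, hF⟩
    | succ n ih =>
      obtain ⟨h₁, h₂, h₃⟩ := ih
      refine ⟨fun y => (h₂ y).exists_isMinOn (h₁ y) (hφ n).continuousOn, fun y => ?_,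
        fun C hC => measurableSet_hit_argmin h₂ h₃ (hφ n) hC⟩
      have hcl : IsClosed {x | ∀ z ∈ G n y, φ n x ≤ φ n z} := by
        simp only [ofPred_forall]
        exact isClosed_biInter fun z _ => isClosed_le (hφ n) continuous_const
      exact (h₂ y).inter_right hcl
  have hmono (n : ℕ) (y : Y) : G (n + 1) y ⊆ G n y := fun _ hx => hx.1
  have hinter (y : Y) {C : Set X} (hC : IsClosed C) (h : ∀ n, (G n y ∩ C).Nonempty) :
      (⋂ n, G n y ∩ C).Nonempty :=
    IsCompact.nonempty_iInter_of_sequence_nonempty_isCompact_isClosed _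
      (fun n => inter_subset_inter_left _ (hmono n y)) h (((hG 0).2.1 y).inter_right hC)
      (fun n => ((hG n).2.1 y).isClosed.inter hC)
  have hex (y : Y) : ∃ x, ∀ n, x ∈ G n y := by
    obtain ⟨x, hx⟩ := hinter y isClosed_univ (fun n => by simpa using (hG n).1 y)
    exact ⟨x, fun n => (mem_iInter.mp hx n).1⟩
  have huniq (y : Y) (x z : X) (hx : ∀ n, x ∈ G n y) (hz : ∀ n, z ∈ G n y) : x = z := by
    have heq (n : ℕ) : φ n x = φ n z :=
      le_antisymm ((hx (n + 1)).2 (hz n)) ((hz (n + 1)).2 (hx n))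
    have hfun : (fun w => dist x w) = fun w => dist z w :=
      (TopologicalSpace.denseRange_denseSeq X).equalizer (continuous_const.dist continuous_id)
        (continuous_const.dist continuous_id) (funext heq)
    exact dist_eq_zero.mp (by simpa using congrFun hfun z)
  choose r hr using hex
  refine ⟨r, measurable_of_isClosed fun C hC => ?_, fun y => hr y 0⟩
  have hpre : r ⁻¹' C = ⋂ n, {y | (G n y ∩ C).Nonempty} := by
    ext y
    simp only [mem_preimage, mem_iInter, mem_ofPred_eq]
    refine ⟨fun h n => ⟨r y, hr y n, h⟩, fun h => ?_⟩
    obtain ⟨x, hx⟩ := hinter y hC h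
    rw [mem_iInter] at hx
    rw [huniq y (r y) x (hr y) fun n => (hx n).1]
    exact (hx 0).2
  rw [hpre]
  exact MeasurableSet.iInter fun n => (hG n).2.2 C hC

/-- A proper surjection from a separable metric space has a Borel right inverse. -/
theorem IsProperMap.exists_measurable_rightInverse {X Y : Type*} [MetricSpace X]
    [TopologicalSpace.SeparableSpace X] [MeasurableSpace X] [BorelSpace X]
    [TopologicalSpace Y] [T1Space Y] [MeasurableSpace Y] [BorelSpace Y] {f : X → Y}
    (hf : IsProperMap f) (hsurj : Function.Surjective f) :
    ∃ r : Y → X, Measurable r ∧ ∀ y, f (r y) = y := by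
  refine exists_measurable_selection_of_isCompact (fun y => f ⁻¹' {y})
    (fun y => hsurj y) (fun y => hf.isCompact_preimage isCompact_singleton) fun C hC => ?_
  have himage : {y | (f ⁻¹' {y} ∩ C).Nonempty} = f '' C := by
    ext y
    exact ⟨fun ⟨x, hx, hxC⟩ => ⟨x, hxC, hx⟩, fun ⟨x, hxC, hx⟩ => ⟨x, hx, hxC⟩⟩
  rw [himage]
  exact (hf.isClosedMap C hC).measurableSet

/-- Arzelà–Ascoli for uniformly Lipschitz families with values in a compact set. -/
theorem ContinuousMap.isCompact_of_dist_le_mul {X Y : Type*} [PseudoMetricSpace X]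
    [CompactSpace X] [MetricSpace Y] {s : Set Y} (hs : IsCompact s) {K : Set C(X, Y)}
    (hK : IsClosed K) (hKs : ∀ f ∈ K, ∀ x, f x ∈ s) {L : ℝ}
    (hL : ∀ f ∈ K, ∀ x y, dist (f x) (f y) ≤ L * dist x y) : IsCompact K := by
  let e := (ContinuousMap.isometryEquivBoundedOfCompact X Y).toHomeomorph
  rw [← e.symm.isCompact_preimage]
  refine BoundedContinuousFunction.arzela_ascoli₂ s hs _ (hK.preimage e.symm.continuous)
    (fun f x hf => hKs _ hf x) ?_
  refine Metric.equicontinuous_of_continuity_modulus (fun d => L * d) ?_ _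
    fun x y f => hL _ f.2 x y
  simpa using (continuous_const_mul L).tendsto (0 : ℝ)

/-- A curve along which a continuous function `τ` is strictly increasing can be reparametrized
by the values of `τ`. -/
theorem exists_reparametrization {M : Type*} [TopologicalSpace M] {τ : M → ℝ}
    (hτ : Continuous τ) {a b : ℝ} (ρ : C(unitInterval, M)) (hρ : StrictMono fun s => τ (ρ s))
    (h₀ : τ (ρ 0) = a) (h₁ : τ (ρ 1) = b) :
    ∃ θ : C(Icc a b, unitInterval), StrictMono θ ∧ ∀ t, τ (ρ (θ t)) = t := by
  let f (s : unitInterval) : Icc a b :=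
    ⟨τ (ρ s), h₀ ▸ hρ.monotone s.2.1, h₁ ▸ hρ.monotone s.2.2⟩
  have hf : StrictMono f := fun s t h => hρ h
  have hsurj : Function.Surjective f := fun t => by
    obtain ⟨s, hs⟩ := mem_range_of_exists_le_of_exists_ge (hτ.comp ρ.continuous)
      ⟨0, h₀.le.trans t.2.1⟩ ⟨1, t.2.2.trans h₁.ge⟩
    exact ⟨s, Subtype.ext hs⟩
  let e := hf.orderIsoOfSurjective f hsurj
  refine ⟨⟨e.symm, e.symm.continuous⟩, e.symm.strictMono, fun t => ?_⟩
  exact congrArg Subtype.val (e.apply_symm_apply t)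

open Set Topology

/-- Let `M` be a globally hyperbolic spacetime (axiomatized: Polish
space, closed causal relation `causal` which is reflexive and transitive, continuous
Cauchy temporal function `𝒯` strictly increasing along causality — a time function —
compact causal diamonds, the local Lipschitz bound `hspeed`, and the existence of
connecting continuous causal curves between causally related points). Let
`A = A_𝒯^{[a,b]}` with the compact-open topology and
`S = J⁺ ∩ (M_a × M_b) = {(p,q) : p ⪯ q, 𝒯(p) = a, 𝒯(q) = b}`. Then the map
`(ev_a, ev_b) : A → S`, `γ ↦ (γ(a),γ(b))`, is a continuous proper surjection admitting a
Borel measurable right inverse. -/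
theorem statement18 {M : Type*} [MetricSpace M] [ProperSpace M] [SecondCountableTopology M]
    [MeasurableSpace M] [BorelSpace M]
    (causal : M → M → Prop)
    (hrefl : ∀ p : M, causal p p) (htrans : Transitive causal)
    (hclosed : IsClosed {x : M × M | causal x.1 x.2})
    (𝒯 : M → ℝ) (h𝒯 : Continuous 𝒯)
    (htime : ∀ p q : M, causal p q → p ≠ q → 𝒯 p < 𝒯 q)
    (hdiamond : ∀ K₁ K₂ : Set M, IsCompact K₁ → IsCompact K₂ →
      IsCompact {r : M | ∃ p ∈ K₁, ∃ q ∈ K₂, causal p r ∧ causal r q})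
    (hspeed : ∀ C : Set M, IsCompact C → ∃ L : ℝ, ∀ p q : M, p ∈ C → q ∈ C →
      causal p q → dist p q ≤ L * (𝒯 q - 𝒯 p))
    (hconn : ∀ p q : M, causal p q → p ≠ q → ∃ ρ : C(unitInterval, M),
      ρ 0 = p ∧ ρ 1 = q ∧
      ∀ s t : unitInterval, (s : ℝ) < (t : ℝ) → causal (ρ s) (ρ t) ∧ ρ s ≠ ρ t)
    (a b : ℝ) (hab : a < b)
    [MeasurableSpace C(Icc a b, M)] [BorelSpace C(Icc a b, M)]
    (A : Set C(Icc a b, M))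
    (hA : A = {γ : C(Icc a b, M) | (∀ t : Icc a b, 𝒯 (γ t) = (t : ℝ)) ∧
        ∀ s t : Icc a b, (s : ℝ) ≤ (t : ℝ) → causal (γ s) (γ t)})
    (S : Set (M × M))
    (hS : S = {x : M × M | causal x.1 x.2 ∧ 𝒯 x.1 = a ∧ 𝒯 x.2 = b})
    (ev : A → S)
    (hev : ∀ γ : A, (ev γ : M × M) =
      ((γ : C(Icc a b, M)) ⟨a, Set.left_mem_Icc.mpr hab.le⟩,
       (γ : C(Icc a b, M)) ⟨b, Set.right_mem_Icc.mpr hab.le⟩)) :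
    Continuous ev ∧
    (∀ K : Set S, IsCompact K → IsCompact (ev ⁻¹' K)) ∧
    Function.Surjective ev ∧
    ∃ r : S → A, Measurable r ∧ ∀ x : S, ev (r x) = x := by
  have hends : Continuous fun γ : C(Icc a b, M) =>
      (γ ⟨a, left_mem_Icc.mpr hab.le⟩, γ ⟨b, right_mem_Icc.mpr hab.le⟩) := by fun_prop
  have hcont : Continuous ev := by
    rw [continuous_induced_rng]
    exact (hends.comp continuous_subtype_val).congr fun γ => (hev γ).symm
  have hAclosed : IsClosed A := by
    rw [hA, ofPred_and]
    simp only [ofPred_forall]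
    refine IsClosed.inter (isClosed_iInter fun t => ?_)
      (isClosed_iInter fun s => isClosed_iInter fun t => isClosed_iInter fun _ => ?_)
    · exact isClosed_eq (h𝒯.comp (continuous_eval_const t)) continuous_const
    · exact hclosed.preimage ((continuous_eval_const s).prodMk
        (continuous_eval_const t))
  have hproper : ∀ K : Set S, IsCompact K → IsCompact (ev ⁻¹' K) := by
    intro K hK
    have hK' : IsCompact (Subtype.val '' K) := hK.image continuous_subtype_val
    have hD := hdiamond _ _ (hK'.image continuous_fst) (hK'.image continuous_snd)
    obtain ⟨L, hL⟩ := hspeed _ hD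
    rw [Subtype.isCompact_iff]
    have himage : Subtype.val '' (ev ⁻¹' K) = A ∩ (fun γ : C(Icc a b, M) =>
        (γ ⟨a, left_mem_Icc.mpr hab.le⟩, γ ⟨b, right_mem_Icc.mpr hab.le⟩)) ⁻¹'
          (Subtype.val '' K) := by
      ext γ
      constructor
      · rintro ⟨γ, hγ, rfl⟩
        exact ⟨γ.2, ev γ, hγ, hev γ⟩
      · rintro ⟨hγ, x, hx, hxγ⟩
        refine ⟨⟨γ, hγ⟩, ?_, rfl⟩
        have : ev ⟨γ, hγ⟩ = x := Subtype.ext ((hev _).trans hxγ.symm)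
        rwa [mem_preimage, this]
    rw [himage]
    have hmem : ∀ γ ∈ A ∩ (fun γ : C(Icc a b, M) =>
        (γ ⟨a, left_mem_Icc.mpr hab.le⟩, γ ⟨b, right_mem_Icc.mpr hab.le⟩)) ⁻¹'
          (Subtype.val '' K), ∀ t, γ t ∈ {r : M | ∃ p ∈ Prod.fst '' (Subtype.val '' K),
            ∃ q ∈ Prod.snd '' (Subtype.val '' K), causal p r ∧ causal r q} := by
      rintro γ ⟨hγ, hγK⟩ t
      rw [hA] at hγ
      exact ⟨_, mem_image_of_mem _ hγK, _, mem_image_of_mem _ hγK,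
        hγ.2 _ _ t.2.1, hγ.2 _ _ t.2.2⟩
    refine ContinuousMap.isCompact_of_dist_le_mul hD
      (hAclosed.inter (hK'.isClosed.preimage hends)) hmem (L := L) fun γ hγ s t => ?_
    have hγA := hγ.1
    rw [hA] at hγA
    wlog hst : (s : ℝ) ≤ t generalizing s t
    · rw [dist_comm, dist_comm s]
      exact this t s (le_of_not_ge hst)
    have h := hL _ _ (hmem γ hγ s) (hmem γ hγ t) (hγA.2 s t hst)
    rwa [hγA.1, hγA.1, ← abs_of_nonneg (sub_nonneg.mpr hst), ← Real.dist_eq,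
      ← Subtype.dist_eq, dist_comm t] at h
  have hsurj : Function.Surjective ev := by
    rintro ⟨⟨p, q⟩, hx⟩
    have hpq := hx
    rw [hS] at hpq
    obtain ⟨hc, hp, hq⟩ := hpq
    simp only at hc hp hq
    obtain ⟨ρ, hρ₀, hρ₁, hρ⟩ := hconn p q hc fun h => by subst h; linarith
    have hmono : StrictMono fun s => 𝒯 (ρ s) := fun s t h =>
      htime _ _ (hρ s t h).1 (hρ s t h).2
    obtain ⟨θ, hθ, hθτ⟩ := exists_reparametrization (a := a) (b := b) h𝒯 ρ hmono
      (by rw [hρ₀, hp]) (by rw [hρ₁, hq])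
    have hγ : ρ.comp θ ∈ A := by
      rw [hA]
      refine ⟨hθτ, fun s t hst => ?_⟩
      rcases eq_or_lt_of_le (show s ≤ t from hst) with rfl | h
      · exact hrefl _
      · exact (hρ _ _ (hθ h)).1
    refine ⟨⟨_, hγ⟩, Subtype.ext ((hev _).trans (Prod.ext ?_ ?_))⟩
    · have : θ ⟨a, left_mem_Icc.mpr hab.le⟩ = 0 :=
        hmono.injective (by simp only [hθτ, hρ₀, hp])
      simp [this, hρ₀]
    · have : θ ⟨b, right_mem_Icc.mpr hab.le⟩ = 1 :=
        hmono.injective (by simp only [hθτ, hρ₁, hq])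
      simp [this, hρ₁]
  exact ⟨hcont, hproper, hsurj,
    (isProperMap_iff_isCompact_preimage.mpr
      ⟨hcont, fun K hK => hproper K hK⟩).exists_measurable_rightInverse hsurj⟩
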